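/- arXiv:1104.2795 — 7 statements merged into one kernel-verified Lean document; each statement's English description precedes it below -/
import Mathlib

section
/- Every locally compact, Hausdorff, perfectly normal, metacompact topological space is paracompact. -/
/-- A space is *metacompact* if every open cover has an open refinement that is
point-finite: each point lies in only finitely many members of the refinement. -/
def IsMetacompact (X : Type*) [TopologicalSpace X] : Prop :=
  ∀ 𝒰 : Set (Set X), (∀ U ∈ 𝒰, IsOpen U) → ⋃₀ 𝒰 = Set.univ →
    ∃ 𝒱 : Set (Set X), (∀ V ∈ 𝒱, IsOpen V) ∧ ⋃₀ 𝒱 = Set.univ ∧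
      (∀ V ∈ 𝒱, ∃ U ∈ 𝒰, V ⊆ U) ∧ ∀ x : X, {V ∈ 𝒱 | x ∈ V}.Finite

open Set Topology

/-- A compact space in which every closed set is a `Gδ` is hereditarily Lindelöf. -/
theorem HereditarilyLindelofSpace.of_isClosed_isGδ {K : Type*} [TopologicalSpace K]
    [CompactSpace K] (h : ∀ s : Set K, IsClosed s → IsGδ s) : HereditarilyLindelofSpace K := by
  refine HereditarilyLindelofSpace.of_forall_isOpen fun s hs ↦ ?_
  obtain ⟨U, hUo, hU⟩ := (h sᶜ hs.isClosed_compl).eq_iInter_nat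
  rw [← compl_compl s, hU, compl_iInter]
  exact isLindelof_iUnion fun n ↦ (hUo n).isClosed_compl.isCompact.isLindelof

/-- If an open family is point-finite, the points lying in at most `n` members form a closed
set. -/
theorem isClosed_setOf_encard_le {K ι : Type*} [TopologicalSpace K] {U : ι → Set K}
    (hUo : ∀ i, IsOpen (U i)) (hU : ∀ x, {i | x ∈ U i}.Finite) (n : ℕ) :
    IsClosed {x | {i | x ∈ U i}.encard ≤ n} := by
  rw [← isOpen_compl_iff, isOpen_iff_mem_nhds]
  intro x hx
  filter_upwards [(Filter.biInter_mem (hU x)).2 fun i hi ↦ (hUo i).mem_nhds hi] with y hy hyn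
  exact hx ((encard_le_encard fun i hi ↦ mem_iInter₂.1 hy i hi).trans hyn)

/-- In a Baire space, every nonempty open set contains a nonempty open set that meets only
finitely many members of a given point-finite open family. -/
theorem exists_isOpen_subset_finite_inter_nonempty {K ι : Type*} [TopologicalSpace K]
    [BaireSpace K] {U : ι → Set K} (hUo : ∀ i, IsOpen (U i)) (hU : ∀ x, {i | x ∈ U i}.Finite)
    {W : Set K} (hWo : IsOpen W) (hW : W.Nonempty) :
    ∃ V ⊆ W, IsOpen V ∧ V.Nonempty ∧ {i | (U i ∩ V).Nonempty}.Finite := by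
  have hcover : ⋃ n : ℕ, {x | {i | x ∈ U i}.encard ≤ n} = univ :=
    iUnion_eq_univ_iff.2 fun x ↦ ⟨(hU x).toFinset.card, (hU x).encard_eq_coe_toFinset_card.le⟩
  obtain ⟨y, hyW, hy⟩ := (dense_iUnion_interior_of_closed
    (isClosed_setOf_encard_le hUo hU) hcover).inter_open_nonempty W hWo hW
  obtain ⟨n, hn⟩ := mem_iUnion.1 hy
  set V₀ := W ∩ interior {x | {i | x ∈ U i}.encard ≤ (n : ℕ∞)}
  have hV₀o : IsOpen V₀ := hWo.inter isOpen_interior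
  have hle : ∀ x ∈ V₀, {i | x ∈ U i}.ncard ≤ n := fun x hx ↦ by
    have hxn : x ∈ {x | {i | x ∈ U i}.encard ≤ (n : ℕ∞)} := interior_subset hx.2
    rwa [mem_ofPred_eq, ← (hU x).cast_ncard_eq, Nat.cast_le] at hxn
  have hbdd : BddAbove ((fun x ↦ {i | x ∈ U i}.ncard) '' V₀) :=
    ⟨n, forall_mem_image.2 hle⟩
  have hV₀ne : V₀.Nonempty := ⟨y, hyW, hn⟩
  obtain ⟨x, hx, hmax⟩ := Nat.sSup_mem (hV₀ne.image _) hbdd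
  refine ⟨V₀ ∩ ⋂ i ∈ {i | x ∈ U i}, U i, fun z hz ↦ hz.1.1,
    hV₀o.inter ((hU x).isOpen_biInter fun i _ ↦ hUo i), ⟨x, hx, mem_iInter₂.2 fun i hi ↦ hi⟩,
    (hU x).subset ?_⟩
  rintro i ⟨z, hzi, hz, hzx⟩
  have hsub : {i | x ∈ U i} ⊆ {i | z ∈ U i} := fun j hj ↦ mem_iInter₂.1 hzx j hj
  have hcard : {i | z ∈ U i}.ncard ≤ {i | x ∈ U i}.ncard :=
    (le_csSup hbdd (mem_image_of_mem _ hz)).trans hmax.ge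
  rw [eq_of_subset_of_ncard_le hsub hcard (hU z)]
  exact hzi

/-- In a hereditarily Lindelöf Baire space, a point-finite open family has only countably many
nonempty members. -/
theorem countable_setOf_nonempty_of_pointFinite {K ι : Type*} [TopologicalSpace K] [BaireSpace K]
    [HereditarilyLindelofSpace K] {U : ι → Set K} (hUo : ∀ i, IsOpen (U i))
    (hU : ∀ x, {i | x ∈ U i}.Finite) : {i | (U i).Nonempty}.Countable := by
  let G : {V : Set K // IsOpen V ∧ {i | (U i ∩ V).Nonempty}.Finite} → Set K := Subtype.val
  obtain ⟨t, htc, ht⟩ := eq_open_union_countable G fun V ↦ V.2.1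
  refine (htc.biUnion fun V _ ↦ V.2.2.countable).mono fun i hi ↦ ?_
  obtain ⟨V, hVi, hVo, ⟨x, hx⟩, hVf⟩ :=
    exists_isOpen_subset_finite_inter_nonempty hUo hU (hUo i) hi
  have hxG : x ∈ ⋃ V ∈ t, G V := ht ▸ mem_iUnion.2 ⟨⟨V, hVo, hVf⟩, hx⟩
  obtain ⟨V', hV't, hxV'⟩ := mem_iUnion₂.1 hxG
  exact mem_iUnion₂.2 ⟨V', hV't, x, hVi hx, hxV'⟩

/-- In a Hausdorff space whose closed sets are `Gδ`, a compact set meets only countably many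
members of a point-finite open family. -/
theorem IsCompact.countable_inter_nonempty_of_pointFinite {X : Type*} [TopologicalSpace X]
    [T2Space X] (hX : ∀ s : Set X, IsClosed s → IsGδ s) {K : Set X} (hK : IsCompact K)
    {𝒱 : Set (Set X)} (hVo : ∀ V ∈ 𝒱, IsOpen V) (hV : ∀ x, {V ∈ 𝒱 | x ∈ V}.Finite) :
    {V ∈ 𝒱 | (V ∩ K).Nonempty}.Countable := by
  have : CompactSpace K := isCompact_iff_compactSpace.1 hK
  have : HereditarilyLindelofSpace K := .of_isClosed_isGδ fun s hs ↦ by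
    have := (hX _ (hK.isClosed.isClosedEmbedding_subtypeVal.isClosedMap s hs)).preimage
      (continuous_subtype_val (p := (· ∈ K)))
    rwa [preimage_image_eq _ Subtype.val_injective] at this
  have hc := countable_setOf_nonempty_of_pointFinite (K := K)
    (U := fun V : 𝒱 ↦ Subtype.val ⁻¹' V.1)
    (fun V ↦ (hVo V V.2).preimage continuous_subtype_val)
    (fun x ↦ Finite.of_finite_image ((hV x).subset (by
      rintro _ ⟨V, hxV, rfl⟩
      exact ⟨V.2, hxV⟩)) Subtype.val_injective.injOn)
  refine (hc.image Subtype.val).mono ?_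
  rintro V ⟨hV𝒱, x, hxV, hxK⟩
  exact ⟨⟨V, hV𝒱⟩, ⟨⟨x, hxK⟩, hxV⟩, rfl⟩

/-- A space that is partitioned into open paracompact subspaces is paracompact. -/
theorem IsLocallyConstant.paracompactSpace {X ι : Type*} [TopologicalSpace X] {f : X → ι}
    (hf : IsLocallyConstant f) (h : ∀ i, ParacompactSpace (f ⁻¹' {i})) : ParacompactSpace X where
  locallyFinite_refinement α s hso hs := by
    have hopen : ∀ i, IsOpen (f ⁻¹' {i}) := fun i ↦ hf {i}
    choose t hto ht htf hts using fun i ↦ precise_refinement (X := f ⁻¹' {i})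
      (fun a ↦ Subtype.val ⁻¹' s a) (fun a ↦ (hso a).preimage continuous_subtype_val)
      (by rw [← preimage_iUnion, hs, preimage_univ])
    refine ⟨α, fun a ↦ ⋃ i, Subtype.val '' t i a,
      fun a ↦ isOpen_iUnion fun i ↦ (hopen i).isOpenMap_subtype_val _ (hto i a),
      iUnion_eq_univ_iff.2 fun x ↦ ?_, fun x ↦ ?_, fun a ↦ ⟨a, ?_⟩⟩
    · obtain ⟨a, ha⟩ := iUnion_eq_univ_iff.1 (ht (f x)) ⟨x, rfl⟩
      exact ⟨a, mem_iUnion.2 ⟨f x, _, ha, rfl⟩⟩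
    · obtain ⟨N, hN, hNf⟩ := htf (f x) ⟨x, rfl⟩
      refine ⟨Subtype.val '' N, (hopen (f x)).isOpenMap_subtype_val.image_mem_nhds hN,
        hNf.subset ?_⟩
      rintro a ⟨_, hz, z, hzN, rfl⟩
      obtain ⟨i, w, hw, hwz⟩ := mem_iUnion.1 hz
      obtain rfl : i = f x := by
        rw [← show f w = i from w.2, hwz]
        exact z.2
      obtain rfl := Subtype.ext hwz
      exact ⟨w, hw, hzN⟩
    · rintro _ hx
      obtain ⟨i, w, hw, rfl⟩ := mem_iUnion.1 hx
      exact hts i a hw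

/-- If every element has only countably many successors, then only countably many elements are
reachable from a given one. -/
theorem countable_setOf_reflTransGen {α : Type*} {r : α → α → Prop}
    (hr : ∀ a, {b | r a b}.Countable) (a : α) : {b | Relation.ReflTransGen r a b}.Countable := by
  let A : ℕ → Set α := fun n ↦ n.rec {a} fun _ B ↦ ⋃ b ∈ B, {c | r b c}
  have hA : ∀ n, (A n).Countable := fun n ↦ by
    induction n with
    | zero => exact countable_singleton a
    | succ n ih => exact ih.biUnion fun b _ ↦ hr b
  refine (countable_iUnion hA).mono fun b hb ↦ ?_
  induction hb with
  | refl => exact mem_iUnion.2 ⟨0, rfl⟩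
  | tail _ hbc ih =>
    obtain ⟨n, hn⟩ := mem_iUnion.1 ih
    exact mem_iUnion.2 ⟨n + 1, mem_iUnion₂.2 ⟨_, hn, hbc⟩⟩

/-- A Hausdorff space with a star-countable cover by relatively compact open sets is
paracompact. -/
theorem ParacompactSpace.of_starCountable {X : Type*} [TopologicalSpace X] [T2Space X]
    [WeaklyLocallyCompactSpace X] {𝒱 : Set (Set X)} (hVo : ∀ V ∈ 𝒱, IsOpen V)
    (hV : ⋃₀ 𝒱 = univ) (hVc : ∀ V ∈ 𝒱, IsCompact (closure V))
    (hstar : ∀ V ∈ 𝒱, {W ∈ 𝒱 | (W ∩ V).Nonempty}.Countable) : ParacompactSpace X := by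
  let r : X → X → Prop := fun x y ↦ ∃ V ∈ 𝒱, x ∈ V ∧ y ∈ V
  let f : X → Quot r := Quot.mk r
  have hf : IsLocallyConstant f := (IsLocallyConstant.iff_eventually_eq f).2 fun x ↦ by
    obtain ⟨V, hV𝒱, hxV⟩ := mem_sUnion.1 (hV.ge (mem_univ x))
    filter_upwards [(hVo V hV𝒱).mem_nhds hxV] with y hy
    exact Quot.sound ⟨V, hV𝒱, hy, hxV⟩
  refine hf.paracompactSpace fun q ↦ ?_
  have hclosed : IsClosed (f ⁻¹' {q}) := hf.isClosed_fiber q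
  have : LocallyCompactSpace (f ⁻¹' {q}) := hclosed.isClosedEmbedding_subtypeVal.locallyCompactSpace
  suffices SigmaCompactSpace (f ⁻¹' {q}) from inferInstance
  rw [← isSigmaCompact_iff_sigmaCompactSpace]
  induction q using Quot.ind with | mk x
  obtain ⟨V, hV𝒱, hxV⟩ := mem_sUnion.1 (hV.ge (mem_univ x))
  let R : 𝒱 → 𝒱 → Prop := fun V W ↦ (W.1 ∩ V.1).Nonempty
  have hR : ∀ V, {W | R V W}.Countable := fun V ↦ by
    refine ((hstar V V.2).preimage Subtype.val_injective).mono ?_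
    exact fun W hW ↦ ⟨W.2, hW⟩
  have hcount := countable_setOf_reflTransGen hR ⟨V, hV𝒱⟩
  set A := {W | Relation.ReflTransGen R ⟨V, hV𝒱⟩ W}
  have hstep : ∀ y z, r y z → (y ∈ ⋃ W ∈ A, W.1) → z ∈ ⋃ W ∈ A, W.1 := by
    rintro y z ⟨W', hW', hy', hz'⟩ hy
    obtain ⟨W, hW, hyW⟩ := mem_iUnion₂.1 hy
    exact mem_iUnion₂.2 ⟨⟨W', hW'⟩, Relation.ReflTransGen.tail hW ⟨y, hy', hyW⟩, hz'⟩
  have hiff : ∀ y z, r y z → ((y ∈ ⋃ W ∈ A, W.1) = (z ∈ ⋃ W ∈ A, W.1)) := fun y z h ↦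
    propext ⟨hstep y z h, hstep z y (h.imp fun _ h ↦ ⟨h.1, h.2.2, h.2.1⟩)⟩
  have hsub : f ⁻¹' {f x} ⊆ ⋃ W ∈ A, closure W.1 := fun y hy ↦ by
    have hyx : (y ∈ ⋃ W ∈ A, W.1) = (x ∈ ⋃ W ∈ A, W.1) := congrArg (Quot.lift _ hiff) hy
    exact iUnion₂_mono (fun W _ ↦ subset_closure)
      (hyx.mpr (mem_iUnion₂.2 ⟨_, Relation.ReflTransGen.refl, hxV⟩))
  exact (isSigmaCompact_biUnion hcount fun W _ ↦ (hVc W W.2).isSigmaCompact).of_isClosed_subset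
    hclosed hsub

/-- Every locally compact, Hausdorff, perfectly normal, metacompact space is
paracompact. -/
theorem locallyCompact_perfectlyNormal_metacompact_paracompact
    (X : Type*) [TopologicalSpace X] [T2Space X] [WeaklyLocallyCompactSpace X]
    [PerfectlyNormalSpace X] (hmc : IsMetacompact X) :
    ParacompactSpace X := by
  obtain ⟨𝒱, hVo, hV, hVU, hVf⟩ := hmc {U | IsOpen U ∧ IsCompact (closure U)} (fun U hU ↦ hU.1)
    (eq_univ_of_forall fun x ↦ by
      obtain ⟨K, hK, hxK⟩ := exists_compact_mem_nhds x
      exact ⟨interior K, ⟨isOpen_interior, hK.closure_of_subset interior_subset⟩,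
        mem_interior_iff_mem_nhds.2 hxK⟩)
  have hVc : ∀ V ∈ 𝒱, IsCompact (closure V) := fun V hV𝒱 ↦ by
    obtain ⟨U, hU, hVU⟩ := hVU V hV𝒱
    exact hU.2.closure_of_subset (hVU.trans subset_closure)
  refine .of_starCountable hVo hV hVc fun V hV𝒱 ↦ ?_
  refine ((hVc V hV𝒱).countable_inter_nonempty_of_pointFinite
    (fun _ hs ↦ PerfectlyNormalSpace.closed_gdelta hs) hVo hVf).mono ?_
  rintro W ⟨hW𝒱, hW⟩
  exact ⟨hW𝒱, hW.mono (inter_subset_inter_right W subset_closure)⟩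
end

section
/- Assume MA_{ω₁}: for every nonempty partial order P satisfying the countable chain condition (every antichain of P is countable) and every family D of at most ℵ₁ dense subsets of P, there is a filter on P meeting every member of D. Let X be a set and let {B_α : α < ω₁} be subsets of X such that whenever {F_α : α < ω₁} is a pairwise disjoint family of finite subsets of ω₁, the family of sets {⋃_{β ∈ F_α} B_β : α < ω₁} is not centered (i.e., some finite subfamily has empty intersection). Let {Y_α : α < ω₁} be countable subsets of X such that for every α < ω₁ and every finite F ⊆ ω₁ \ {α}, the set Y_α \ ⋃_{β ∈ F} B_β is infinite. Then there are sets A_n (n ∈ ω) with ω₁ = ⋃_{n<ω} A_n such that for each n ∈ ω and each α < ω₁, the set Y_α \ ⋃{B_β : β ∈ A_n \ {α}} is infinite. -/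
universe u

/-- A partial order satisfies the *countable chain condition* if every antichain
(set of pairwise incompatible elements) is countable. -/
def PosetCCC (P : Type u) [PartialOrder P] : Prop :=
  ∀ A : Set P, (∀ p ∈ A, ∀ q ∈ A, p ≠ q → ¬∃ r, r ≤ p ∧ r ≤ q) → A.Countable

/-- A subset of a partial order is *dense* if every element has a lower bound in it. -/
def PosetDense {P : Type u} [PartialOrder P] (D : Set P) : Prop :=
  ∀ p : P, ∃ q ∈ D, q ≤ p

/-- A *filter* on a partial order: a nonempty, upward-closed, downward-directed subset. -/
def IsPosetFilter {P : Type u} [PartialOrder P] (G : Set P) : Prop :=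
  G.Nonempty ∧ (∀ p ∈ G, ∀ q, p ≤ q → q ∈ G) ∧
    ∀ p ∈ G, ∀ q ∈ G, ∃ r ∈ G, r ≤ p ∧ r ≤ q

/-- Martin's Axiom for ℵ₁ dense sets: for every nonempty c.c.c. partial order `P` and
every family of at most ℵ₁ dense subsets of `P`, there is a filter on `P` meeting
every member of the family. -/
def MAOmega1 : Prop :=
  ∀ (P : Type u) [PartialOrder P] [Nonempty P], PosetCCC P →
    ∀ 𝒟 : Set (Set P), Cardinal.mk 𝒟 ≤ Cardinal.aleph 1 → (∀ D ∈ 𝒟, PosetDense D) →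
      ∃ G : Set P, IsPosetFilter G ∧ ∀ D ∈ 𝒟, (G ∩ D).Nonempty

/-- The first uncountable ordinal. -/
noncomputable def omega1 : Ordinal.{0} := (Cardinal.aleph 1).ord

namespace MADecomposition

open Filter Set

/-- A map from an uncountable set into a countable set has an uncountable fibre. -/
theorem exists_uncountable_fiber {ι κ : Type*} {S : Set ι} (hS : ¬S.Countable) (g : ι → κ)
    {C : Set κ} (hC : C.Countable) (hg : MapsTo g S C) :
    ∃ c ∈ C, ¬(S ∩ g ⁻¹' {c}).Countable := by
  by_contra! h
  refine hS ((hC.biUnion h).mono fun i hi => ?_)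
  exact mem_biUnion (hg hi) ⟨hi, rfl⟩

theorem exists_uncountable_pairwise_inter_eq_of_card {ι I : Type*} [DecidableEq I] (n : ℕ) :
    ∀ (F : ι → Finset I) (S : Set ι), ¬S.Countable → (∀ i ∈ S, (F i).card = n) →
      ∃ T ⊆ S, ¬T.Countable ∧ ∃ R, ∀ i ∈ T, ∀ j ∈ T, i ≠ j → F i ∩ F j = R := by
  induction n with
  | zero =>
    intro F S hS hF
    refine ⟨S, Subset.rfl, hS, ∅, fun i hi j _ _ => ?_⟩
    rw [Finset.card_eq_zero.1 (hF i hi), Finset.empty_inter]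
  | succ n ih =>
    intro F S hS hF
    by_cases hx : ∃ x, ¬{i ∈ S | x ∈ F i}.Countable
    · obtain ⟨x, hx⟩ := hx
      obtain ⟨T, hTS, hT, R, hR⟩ := ih (fun i => (F i).erase x) _ hx fun i hi => by
        rw [Finset.card_erase_of_mem hi.2, hF i hi.1, Nat.add_sub_cancel]
      refine ⟨T, fun i hi => (hTS hi).1, hT, insert x R, fun i hi j hj hij => ?_⟩
      rw [← hR i hi j hj hij]
      ext y
      by_cases hy : y = x
      · simp [hy, (hTS hi).2, (hTS hj).2]
      · simp [hy]
    · push Not at hx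
      obtain ⟨M, hM⟩ := zorn_subset {T : Set ι | T ⊆ S ∧ T.Pairwise (fun i j => F i ∩ F j = ∅)}
        (fun c hc hchain => ⟨⋃₀ c, ⟨sUnion_subset fun t ht => (hc ht).1,
          (pairwise_sUnion hchain.directedOn).2 fun t ht => (hc ht).2⟩,
          fun t ht => subset_sUnion_of_mem ht⟩)
      refine ⟨M, hM.prop.1, fun hMc => hS ?_, ∅, fun i hi j hj hij => hM.prop.2 hi hj hij⟩
      have hcount : (⋃ i ∈ M, ⋃ x ∈ F i, {j ∈ S | x ∈ F j}).Countable :=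
        hMc.biUnion fun i _ => (F i).countable_toSet.biUnion fun x _ => hx x
      refine (hMc.union hcount).mono fun j hj => ?_
      by_contra hjM
      simp only [mem_union, mem_iUnion, not_or, not_exists] at hjM
      have hdisj : ∀ i ∈ M, F j ∩ F i = ∅ := fun i hi => by
        ext x
        simpa using fun hxj hxi => hjM.2 i hi x hxi ⟨hj, hxj⟩
      refine hjM.1 (hM.le_of_ge (y := insert j M) ⟨insert_subset hj hM.prop.1, ?_⟩
        (subset_insert j M) (mem_insert j M))
      refine hM.prop.2.insert fun i hi _ => ⟨hdisj i hi, ?_⟩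
      rw [Finset.inter_comm]
      exact hdisj i hi

/-- The Δ-system lemma for uncountable families of finite sets. -/
theorem exists_uncountable_pairwise_inter_eq {ι I : Type*} [DecidableEq I] (F : ι → Finset I)
    {S : Set ι} (hS : ¬S.Countable) :
    ∃ T ⊆ S, ¬T.Countable ∧ ∃ R, ∀ i ∈ T, ∀ j ∈ T, i ≠ j → F i ∩ F j = R := by
  obtain ⟨n, -, hn⟩ := exists_uncountable_fiber hS (fun i => (F i).card) countable_univ
    (mapsTo_univ _ _)
  obtain ⟨T, hTS, hT⟩ := exists_uncountable_pairwise_inter_eq_of_card n F _ hn fun i hi => hi.2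
  exact ⟨T, fun i hi => (hTS hi).1, hT⟩

/-- If no uncountable subfamily of `C` is centered, then two members of the family are disjoint
from each other's attached `n`-tuples. -/
theorem exists_ne_forall_notMem {ι X : Type*} [Uncountable ι] {n : ℕ} (C : ι → Set X)
    (s : ι → Fin n → X)
    (hC : ∀ K : Set ι, ¬K.Countable → ∃ G : Finset ι, ↑G ⊆ K ∧ ⋂ i ∈ G, C i = ∅) :
    ∃ i j, i ≠ j ∧ (∀ k, s i k ∉ C j) ∧ ∀ k, s j k ∉ C i := by
  by_contra! h
  have hne : (cocountable : Filter ι).NeBot := by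
    refine neBot_iff.2 fun hbot => not_countable_univ (α := ι) ?_
    have := empty_mem_iff_bot.2 hbot
    rwa [mem_cocountable, compl_empty] at this
  obtain ⟨U, hU⟩ := Ultrafilter.exists_le (cocountable : Filter ι)
  have hlarge : ∀ K : Set ι, K ∈ U → ¬K.Countable := fun K hK hKc =>
    Ultrafilter.compl_mem_iff_notMem.1 (hU (mem_cocountable.2 (by rwa [compl_compl]))) hK
  have hfirst : ∀ i k, ¬∀ᶠ j in U, s i k ∈ C j := fun i k hik => by
    obtain ⟨G, hGK, hG⟩ := hC _ (hlarge _ hik)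
    exact (hG ▸ mem_iInter₂.2 fun j hj => hGK hj : s i k ∈ (∅ : Set X))
  have hsecond : ∀ i, ∃ k, ∀ᶠ j in U, s j k ∈ C i := fun i => by
    have hi : ∀ᶠ j in U, (∃ k, s i k ∈ C j) ∨ ∃ k, s j k ∈ C i := by
      have hne : ∀ᶠ j in U, j ≠ i := hU (mem_cocountable.2 (by simp [compl_def]))
      filter_upwards [hne] with j hj
      by_contra! hc
      obtain ⟨k, hk⟩ := h i j hj.symm hc.1
      exact hc.2 k hk
    rw [Ultrafilter.eventually_or, Ultrafilter.eventually_exists_iff,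
      Ultrafilter.eventually_exists_iff] at hi
    exact hi.resolve_left fun ⟨k, hk⟩ => hfirst i k hk
  choose κ hκ using hsecond
  obtain ⟨k, -, hk⟩ := exists_uncountable_fiber (not_countable_univ (α := ι)) κ countable_univ
    (mapsTo_univ _ _)
  obtain ⟨G, hGK, hG⟩ := hC _ hk
  have hall : ∀ᶠ j in U, ∀ i ∈ G, s j k ∈ C i :=
    (eventually_all_finset G).2 fun i hi => by
      have : κ i = k := (hGK hi).2
      exact this ▸ hκ i
  obtain ⟨j, hj⟩ := hall.exists
  exact (hG ▸ mem_iInter₂.2 hj : s j k ∈ (∅ : Set X))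

variable {I X : Type u}

/-- A finite approximation to a decomposition of `I` into countably many pieces: `pieces` decides
finitely many memberships `i ∈ A n`, and a triple `(n, i, x)` in `promises` promises that
`x ∈ Y i` avoids `B j` for all `j ∈ A n` other than `i`. -/
@[ext]
structure Approximation (B Y : I → Set X) where
  pieces : Finset (ℕ × I)
  promises : Finset (ℕ × I × X)
  mem_of_promise : ∀ t ∈ promises, t.2.2 ∈ Y t.2.1
  avoid : ∀ s ∈ pieces, ∀ t ∈ promises, s.1 = t.1 → s.2 ≠ t.2.1 → t.2.2 ∉ B s.2

namespace Approximation

variable {B Y : I → Set X}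

instance : PartialOrder (Approximation B Y) where
  le p q := q.pieces ⊆ p.pieces ∧ q.promises ⊆ p.promises
  le_refl _ := ⟨subset_rfl, subset_rfl⟩
  le_trans _ _ _ hpq hqr := ⟨hqr.1.trans hpq.1, hqr.2.trans hpq.2⟩
  le_antisymm _ _ hpq hqp := Approximation.ext (hqp.1.antisymm hpq.1) (hqp.2.antisymm hpq.2)

instance : Nonempty (Approximation B Y) := ⟨⟨∅, ∅, by simp, by simp⟩⟩

theorem exists_le_of_avoid (p q : Approximation B Y)
    (hpq : ∀ s ∈ p.pieces, ∀ t ∈ q.promises, s.1 = t.1 → s.2 ≠ t.2.1 → t.2.2 ∉ B s.2)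
    (hqp : ∀ s ∈ q.pieces, ∀ t ∈ p.promises, s.1 = t.1 → s.2 ≠ t.2.1 → t.2.2 ∉ B s.2) :
    ∃ r, r ≤ p ∧ r ≤ q := by
  classical
  refine ⟨⟨p.pieces ∪ q.pieces, p.promises ∪ q.promises, fun t ht => ?_, fun s hs t ht => ?_⟩,
    ⟨Finset.subset_union_left, Finset.subset_union_left⟩,
    ⟨Finset.subset_union_right, Finset.subset_union_right⟩⟩
  · exact (Finset.mem_union.1 ht).elim (p.mem_of_promise t) (q.mem_of_promise t)
  · rcases Finset.mem_union.1 hs with hs | hs <;> rcases Finset.mem_union.1 ht with ht | ht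
    exacts [p.avoid s hs t ht, hpq s hs t ht, hqp s hs t ht, q.avoid s hs t ht]

theorem posetCCC
    (hB : ∀ (ι : Type u) [Uncountable ι] (F : ι → Finset I),
      (∀ i j, i ≠ j → Disjoint (F i) (F j)) →
        ∃ G : Finset ι, ⋂ i ∈ G, ⋃ β ∈ F i, B β = ∅) :
    PosetCCC (Approximation B Y) := by
  classical
  intro S hanti
  by_contra hS
  obtain ⟨T₀, hT₀S, hT₀, R, hR⟩ := exists_uncountable_pairwise_inter_eq
    (fun p : Approximation B Y => p.pieces.image Prod.snd) hS
  obtain ⟨D, -, hT₁⟩ := exists_uncountable_fiber hT₀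
    (fun p => {s : ℕ × I | s ∈ p.pieces ∧ s.2 ∈ R})
    (countable_ofPred_finite_subset (countable_univ.prod R.countable_toSet))
    (fun p _ => ⟨p.pieces.finite_toSet.subset fun s hs => hs.1, fun s hs => ⟨mem_univ _, hs.2⟩⟩)
  obtain ⟨n, -, hT⟩ := exists_uncountable_fiber hT₁ (fun p => p.promises.card) countable_univ
    (mapsTo_univ _ _)
  set T := (T₀ ∩ _) ∩ _
  have hunc : Uncountable T := by rwa [← not_countable_iff]
  let a : T → Finset I := fun p => p.1.pieces.image Prod.snd \ R
  let e : ∀ p : T, Fin n ≃ p.1.promises := fun p => (p.1.promises.equivFinOfCardEq p.2.2).symm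
  have ha : ∀ p q, p ≠ q → Disjoint (a p) (a q) := fun p q hpq => by
    refine Finset.disjoint_left.2 fun x hxp hxq => ?_
    rw [Finset.mem_sdiff] at hxp hxq
    refine hxp.2 ?_
    rw [← hR p p.2.1.1 q q.2.1.1 (Subtype.coe_ne_coe.2 hpq)]
    exact Finset.mem_inter.2 ⟨hxp.1, hxq.1⟩
  obtain ⟨p, q, hpq, h₁, h₂⟩ := exists_ne_forall_notMem (fun p => ⋃ β ∈ a p, B β)
    (fun p k => (e p k).1.2.2) fun K hK => by
      have : Uncountable K := by rwa [← not_countable_iff]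
      obtain ⟨G, hG⟩ := hB K (fun p => a p) fun p q hpq => ha p q (Subtype.coe_ne_coe.2 hpq)
      refine ⟨G.map (Function.Embedding.subtype _), by simp, by simpa using hG⟩
  have key : ∀ p q : T, (∀ k, (e p k).1.2.2 ∉ ⋃ β ∈ a q, B β) → ∀ s ∈ q.1.pieces,
      ∀ t ∈ p.1.promises, s.1 = t.1 → s.2 ≠ t.2.1 → t.2.2 ∉ B s.2 := by
    intro p q h s hs t ht hst hne
    by_cases hsR : s.2 ∈ R
    · have hs' : s ∈ {s : ℕ × I | s ∈ p.1.pieces ∧ s.2 ∈ R} := by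
        have hp : _ = D := p.2.1.2
        have hq : _ = D := q.2.1.2
        exact (hq.trans hp.symm).le ⟨hs, hsR⟩
      exact p.1.avoid s hs'.1 t ht hst hne
    · have := h ((e p).symm ⟨t, ht⟩)
      rw [Equiv.apply_symm_apply] at this
      exact fun htB => this (mem_iUnion₂.2
        ⟨s.2, Finset.mem_sdiff.2 ⟨Finset.mem_image_of_mem _ hs, hsR⟩, htB⟩)
  exact hanti p (hT₀S p.2.1.1) q (hT₀S q.2.1.1) (Subtype.coe_ne_coe.2 hpq)
    (exists_le_of_avoid _ _ (key q p h₂) (key p q h₁))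

theorem posetDense_exists_mem_pieces (i : I) :
    PosetDense {p : Approximation B Y | ∃ n, (n, i) ∈ p.pieces} := by
  classical
  intro p
  obtain ⟨n, hn⟩ := Infinite.exists_notMem_finset (p.promises.image Prod.fst)
  refine ⟨⟨insert (n, i) p.pieces, p.promises, p.mem_of_promise, fun s hs t ht hst => ?_⟩,
    ⟨n, Finset.mem_insert_self _ _⟩, Finset.subset_insert _ _, subset_rfl⟩
  rcases Finset.mem_insert.1 hs with rfl | hs
  · exact absurd (Finset.mem_image.2 ⟨t, ht, hst.symm⟩) hn
  · exact p.avoid s hs t ht hst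

theorem posetDense_le_card_promises
    (hY : ∀ (i : I) (F : Finset I), i ∉ F → (Y i \ ⋃ β ∈ F, B β).Infinite) (n : ℕ) (i : I) (k : ℕ) :
    PosetDense {p : Approximation B Y |
      ∃ E : Finset X, k ≤ E.card ∧ ∀ x ∈ E, (n, i, x) ∈ p.promises} := by
  classical
  intro p
  obtain ⟨E, hE, hcard⟩ := (hY i ((p.pieces.image Prod.snd).erase i)
    (Finset.notMem_erase _ _)).exists_subset_card_eq k
  refine ⟨⟨p.pieces, p.promises ∪ E.image fun x => (n, i, x), fun t ht => ?_,
    fun s hs t ht hst hne => ?_⟩,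
    ⟨E, hcard.ge, fun x hx => Finset.mem_union_right _ (Finset.mem_image_of_mem _ hx)⟩,
    subset_rfl, Finset.subset_union_left⟩
  · rcases Finset.mem_union.1 ht with ht | ht
    · exact p.mem_of_promise t ht
    · obtain ⟨x, hx, rfl⟩ := Finset.mem_image.1 ht
      exact (hE hx).1
  · rcases Finset.mem_union.1 ht with ht | ht
    · exact p.avoid s hs t ht hst hne
    · obtain ⟨x, hx, rfl⟩ := Finset.mem_image.1 ht
      exact fun hxB => (hE hx).2 (mem_iUnion₂.2
        ⟨s.2, Finset.mem_erase.2 ⟨hne, Finset.mem_image_of_mem _ hs⟩, hxB⟩)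

end Approximation

/-- The decomposition theorem for families indexed by a set of cardinality at most `ℵ₁`. -/
theorem exists_decomposition (hMA : MAOmega1.{u}) (hI : Cardinal.mk I ≤ Cardinal.aleph 1)
    (B Y : I → Set X)
    (hB : ∀ (ι : Type u) [Uncountable ι] (F : ι → Finset I),
      (∀ i j, i ≠ j → Disjoint (F i) (F j)) →
        ∃ G : Finset ι, ⋂ i ∈ G, ⋃ β ∈ F i, B β = ∅)
    (hY : ∀ (i : I) (F : Finset I), i ∉ F → (Y i \ ⋃ β ∈ F, B β).Infinite) :
    ∃ A : ℕ → Set I, ⋃ n, A n = univ ∧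
      ∀ n i, (Y i \ ⋃ β ∈ A n \ {i}, B β).Infinite := by
  let D : I ⊕ ℕ × I × ℕ → Set (Approximation B Y) := Sum.elim
    (fun i => {p | ∃ n, (n, i) ∈ p.pieces})
    (fun t => {p | ∃ E : Finset X, t.2.2 ≤ E.card ∧ ∀ x ∈ E, (t.1, t.2.1, x) ∈ p.promises})
  have hD : Cardinal.mk (range D) ≤ Cardinal.aleph 1 := by
    have hω := Cardinal.aleph0_le_aleph.{u} 1
    refine Cardinal.mk_range_le.trans ?_
    simp only [Cardinal.mk_sum, Cardinal.mk_prod, Cardinal.lift_id, Cardinal.mk_nat,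
      Cardinal.lift_aleph0, Cardinal.lift_uzero]
    exact Cardinal.add_le_of_le hω hI (Cardinal.mul_le_of_le hω hω (Cardinal.mul_le_of_le hω hI hω))
  obtain ⟨G, ⟨-, -, hdir⟩, hG⟩ := hMA (Approximation B Y) (Approximation.posetCCC hB) (range D) hD
    (forall_mem_range.2 fun t => match t with
      | .inl i => Approximation.posetDense_exists_mem_pieces i
      | .inr (n, i, k) => Approximation.posetDense_le_card_promises hY n i k)
  refine ⟨fun n => {i | ∃ p ∈ G, (n, i) ∈ p.pieces}, eq_univ_of_forall fun i => ?_,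
    fun n i hfin => ?_⟩
  · obtain ⟨p, hpG, n, hn⟩ := hG _ (mem_range_self (.inl i))
    exact mem_iUnion.2 ⟨n, p, hpG, hn⟩
  · obtain ⟨p, hpG, E, hcard, hE⟩ :=
      hG _ (mem_range_self (.inr (n, i, hfin.toFinset.card + 1)))
    refine (Nat.lt_of_succ_le hcard).not_ge (Finset.card_le_card fun x hx => ?_)
    refine hfin.mem_toFinset.2 ⟨p.mem_of_promise _ (hE x hx), fun hxB => ?_⟩
    obtain ⟨j, ⟨⟨q, hqG, hjq⟩, hji⟩, hxj⟩ := mem_iUnion₂.1 hxB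
    obtain ⟨r, -, hrp, hrq⟩ := hdir p hpG q hqG
    exact r.avoid _ (hrq.1 hjq) _ (hrp.2 (hE x hx)) rfl hji hxj

end MADecomposition

/-- (Gruenhage–Koszmider) Assume MA_{ω₁}. Let `{B α : α < ω₁}` be subsets of `X` such
that whenever `{F α : α < ω₁}` is a pairwise disjoint family of finite subsets of ω₁,
the family `{⋃ β ∈ F α, B β : α < ω₁}` is not centered (some finite subfamily has
empty intersection). Let `{Y α : α < ω₁}` be countable subsets of `X` such that
`Y α \ ⋃ β ∈ F, B β` is infinite for every finite `F ⊆ ω₁ \ {α}`. Then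
`ω₁ = ⋃ n, A n` where for each `n` and each `α < ω₁`,
`Y α \ ⋃ β ∈ A n \ {α}, B β` is infinite. -/
theorem MA_decomposition_omega1 (hMA : MAOmega1.{u}) (X : Type u)
    (B Y : Ordinal.{0} → Set X)
    (hB : ∀ F : Ordinal.{0} → Finset Ordinal.{0},
      (∀ α < omega1, ∀ β ∈ F α, β < omega1) →
      (∀ α < omega1, ∀ α' < omega1, α ≠ α' → Disjoint (F α) (F α')) →
      ∃ G : Finset Ordinal.{0}, (∀ α ∈ G, α < omega1) ∧
        (⋂ α ∈ G, ⋃ β ∈ F α, B β) = ∅)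
    (hYcount : ∀ α < omega1, (Y α).Countable)
    (hY : ∀ α < omega1, ∀ F : Finset Ordinal.{0},
      (∀ β ∈ F, β < omega1 ∧ β ≠ α) → (Y α \ ⋃ β ∈ F, B β).Infinite) :
    ∃ A : ℕ → Set Ordinal.{0}, (⋃ n, A n) = Set.Iio omega1 ∧
      ∀ n : ℕ, ∀ α < omega1, (Y α \ ⋃ β ∈ A n \ {α}, B β).Infinite := by
  classical
  obtain ⟨e⟩ : Nonempty ((Cardinal.aleph.{u} 1).out ≃ Set.Iio omega1) := by
    rw [← Cardinal.lift_mk_eq']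
    simp [Cardinal.mk_Iio_ordinal, omega1]
  have he : ∀ i, (e i : Ordinal) < omega1 := fun i => (e i).2
  have hinj : Function.Injective fun i => (e i : Ordinal) :=
    Subtype.val_injective.comp e.injective
  obtain ⟨A, hA, hinf⟩ := MADecomposition.exists_decomposition hMA (Cardinal.mk_out _).le
    (fun i => B (e i)) (fun i => Y (e i))
    (fun ι _ F hF => by
      obtain ⟨f⟩ : Nonempty ((Cardinal.aleph.{u} 1).out ↪ ι) := by
        rw [← Cardinal.le_def, Cardinal.mk_out]
        rw [← Cardinal.succ_aleph0, Order.succ_le_iff, Cardinal.aleph0_lt_mk_iff]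
        infer_instance
      let j : Set.Iio omega1 → ι := fun α => f (e.symm α)
      obtain ⟨G, hG, hempty⟩ := hB
        (fun α => if h : α < omega1 then (F (j ⟨α, h⟩)).map ⟨_, hinj⟩ else ∅)
        (fun α hα β hβ => by
          simp only [hα, dif_pos, Finset.mem_map] at hβ
          obtain ⟨i, -, rfl⟩ := hβ
          exact he i)
        (fun α hα α' hα' hne => by
          simp only [hα, hα', dif_pos, Finset.disjoint_map]
          exact hF _ _ fun h => hne (congrArg Subtype.val (e.symm.injective (f.injective h))))
      refine ⟨G.attach.image fun α : G => j ⟨α, hG α α.2⟩, Set.eq_empty_of_forall_notMem fun x hx => ?_⟩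
      rw [Set.eq_empty_iff_forall_notMem] at hempty
      refine hempty x (Set.mem_iInter₂.2 fun α hα => ?_)
      have hxα := Set.mem_iInter₂.1 hx _ (Finset.mem_image_of_mem _ (Finset.mem_attach G ⟨α, hα⟩))
      simpa [hG α hα] using hxα)
    (fun i F hi => by
      have := hY (e i) (he i) (F.map ⟨_, hinj⟩) (fun β hβ => by
        obtain ⟨k, hk, rfl⟩ := Finset.mem_map.1 hβ
        exact ⟨he k, fun h => hi (hinj h ▸ hk)⟩)
      simpa using this)
  refine ⟨fun n => (fun i => (e i : Ordinal)) '' A n, ?_, fun n α hα => ?_⟩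
  · rw [← Set.image_iUnion, hA, Set.image_univ]
    exact (e.surjective.range_comp Subtype.val).trans Subtype.range_val
  · obtain ⟨i, hi⟩ := e.surjective ⟨α, hα⟩
    obtain rfl : (e i : Ordinal) = α := congrArg Subtype.val hi
    refine (hinf n i).mono (Set.sdiff_subset_sdiff_right fun x hx => ?_)
    obtain ⟨_, ⟨⟨k, hk, rfl⟩, hne⟩, hxk⟩ := Set.mem_iUnion₂.1 hx
    exact Set.mem_iUnion₂.2 ⟨k, ⟨hk, fun h => hne (congrArg (fun i => (e i : Ordinal)) h)⟩, hxk⟩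
end

section
/- Let X be a set, and let {B_α : α < ω₁} and {Y_α : α < ω₁} be families of subsets of X with each Y_α countable. Suppose there is a closed unbounded set C ⊆ ω₁ such that for every α ∈ C, the set Y_α \ ⋃{B_β : β ∈ C \ {α}} is infinite. Then every stationary set S ⊆ ω₁ includes a stationary set T ⊆ S such that for every α ∈ T, the set Y_α \ ⋃{B_β : β ∈ T \ {α}} is infinite. -/
/-- A set of countable ordinals is *closed unbounded* (club) in ω₁ if it is unbounded
in ω₁ and contains the supremum of each of its nonempty subsets whose supremum is
below ω₁. -/
def IsClubBelowOmega1 (C : Set Ordinal.{0}) : Prop :=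
  C ⊆ Set.Iio omega1 ∧ (∀ o < omega1, ∃ c ∈ C, o ≤ c) ∧
    ∀ s : Set Ordinal.{0}, s ⊆ C → s.Nonempty → sSup s < omega1 → sSup s ∈ C

/-- A set of countable ordinals is *stationary* in ω₁ if it meets every closed
unbounded subset of ω₁. -/
def IsStationaryBelowOmega1 (S : Set Ordinal.{0}) : Prop :=
  S ⊆ Set.Iio omega1 ∧ ∀ C : Set Ordinal.{0}, IsClubBelowOmega1 C → (S ∩ C).Nonempty

theorem IsClubBelowOmega1.inter {C D : Set Ordinal.{0}} (hC : IsClubBelowOmega1 C)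
    (hD : IsClubBelowOmega1 D) : IsClubBelowOmega1 (C ∩ D) := by
  obtain ⟨hC_lt, hC_unbounded, hC_closed⟩ := hC
  obtain ⟨hD_lt, hD_unbounded, hD_closed⟩ := hD
  refine ⟨Set.inter_subset_left.trans hC_lt, fun o ho => ?_, fun s hs hne hlt =>
    ⟨hC_closed s (hs.trans Set.inter_subset_left) hne hlt,
      hD_closed s (hs.trans Set.inter_subset_right) hne hlt⟩⟩
  choose! f hf_mem hf_le using hC_unbounded
  choose! g hg_mem hg_le using hD_unbounded
  let a : ℕ → Ordinal.{0} := fun n => (g ∘ f)^[n] o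
  have ha_succ (n : ℕ) : a (n + 1) = g (f (a n)) := Function.iterate_succ_apply' ..
  have ha_lt (n : ℕ) : a n < omega1 := by
    induction n with
    | zero => exact ho
    | succ n ih => exact ha_succ n ▸ hD_lt (hg_mem _ (hC_lt (hf_mem _ ih)))
  have hfa_mem (n : ℕ) : f (a n) ∈ C := hf_mem _ (ha_lt n)
  have ha_mem (n : ℕ) : a (n + 1) ∈ D := ha_succ n ▸ hg_mem _ (hC_lt (hfa_mem n))
  have hfa_le (n : ℕ) : f (a n) ≤ a (n + 1) := ha_succ n ▸ hg_le _ (hC_lt (hfa_mem n))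
  have h_sup : ⨆ n, f (a n) = ⨆ n, a (n + 1) :=
    le_antisymm (Ordinal.iSup_le fun n => (hfa_le n).trans (Ordinal.le_iSup (fun n => a (n + 1)) n))
      (Ordinal.iSup_le fun n =>
        (hf_le _ (ha_lt (n + 1))).trans (Ordinal.le_iSup (fun n => f (a n)) (n + 1)))
  have h_sup_lt : ⨆ n, f (a n) < omega1 := by
    have h := Ordinal.iSup_lt_omega_one (f := fun n => f (a n))
      fun n => (hC_lt (hfa_mem n)).trans_eq (Cardinal.ord_aleph 1)
    exact h.trans_eq (Cardinal.ord_aleph 1).symm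
  refine ⟨⨆ n, f (a n), ⟨?_, ?_⟩, (hf_le o ho).trans (Ordinal.le_iSup (fun n => f (a n)) 0)⟩
  · exact hC_closed _ (Set.range_subset_iff.2 hfa_mem) (Set.range_nonempty _) h_sup_lt
  · rw [h_sup] at h_sup_lt ⊢
    exact hD_closed _ (Set.range_subset_iff.2 ha_mem) (Set.range_nonempty _) h_sup_lt

theorem IsStationaryBelowOmega1.inter_club {S C : Set Ordinal.{0}}
    (hS : IsStationaryBelowOmega1 S) (hC : IsClubBelowOmega1 C) :
    IsStationaryBelowOmega1 (S ∩ C) :=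
  ⟨Set.inter_subset_left.trans hS.1, fun D hD =>
    Set.inter_assoc S C D ▸ hS.2 (C ∩ D) (hC.inter hD)⟩

/-- Let `{B α : α < ω₁}` and `{Y α : α < ω₁}` be families of subsets of `X` with each
`Y α` countable. If there is a club `C ⊆ ω₁` such that `Y α \ ⋃ β ∈ C \ {α}, B β` is
infinite for every `α ∈ C`, then every stationary `S ⊆ ω₁` includes a stationary `T`
such that `Y α \ ⋃ β ∈ T \ {α}, B β` is infinite for every `α ∈ T`. -/
theorem stationary_subset_of_club_property {X : Type*} (B Y : Ordinal.{0} → Set X)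
    (hYcount : ∀ α < omega1, (Y α).Countable)
    (C : Set Ordinal.{0}) (hC : IsClubBelowOmega1 C)
    (hCinf : ∀ α ∈ C, (Y α \ ⋃ β ∈ C \ {α}, B β).Infinite) :
    ∀ S : Set Ordinal.{0}, IsStationaryBelowOmega1 S →
      ∃ T ⊆ S, IsStationaryBelowOmega1 T ∧
        ∀ α ∈ T, (Y α \ ⋃ β ∈ T \ {α}, B β).Infinite := by
  intro S hS
  refine ⟨S ∩ C, Set.inter_subset_left, hS.inter_club hC, fun α hα => (hCinf α hα.2).mono ?_⟩
  exact Set.sdiff_subset_sdiff_right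
    (Set.biUnion_subset_biUnion_left (Set.sdiff_subset_sdiff_left Set.inter_subset_right))
end

section
/- Suppose that every first countable, hereditarily Lindelöf, regular Hausdorff topological space is hereditarily separable. Then every locally compact, Hausdorff, perfectly normal topological space is locally separable, i.e., every point has a separable neighborhood. -/
open Set Filter Topology in
/-- In a compact Hausdorff space, the neighborhood filter of a Gδ point is countably generated. -/
theorem IsGδ.isCountablyGenerated_nhds_of_compactSpace {Y : Type*} [TopologicalSpace Y]
    [CompactSpace Y] [T2Space Y] {p : Y} (hp : IsGδ ({p} : Set Y)) :
    (𝓝 p).IsCountablyGenerated := by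
  obtain ⟨U, hUo, hU⟩ := isGδ_iff_eq_iInter_nat.1 hp
  have hpU : ∀ n, U n ∈ 𝓝 p := fun n ↦
    (hUo n).mem_nhds (mem_iInter.1 (hU ▸ mem_singleton p) n)
  choose V hVp hVc hVU using fun n ↦ exists_mem_nhds_isClosed_subset (hpU n)
  have h : 𝓝 p = ⨅ n, 𝓟 (V n) := by
    refine le_antisymm (le_iInf fun n ↦ le_principal_iff.2 (hVp n)) ?_
    refine le_nhds_of_unique_clusterPt fun y hy ↦ ?_
    have hyU : y ∈ ⋂ n, U n := mem_iInter.2 fun n ↦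
      hVU n ((hVc n).closure_subset (mem_closure_iff_clusterPt.2 (hy.mono (iInf_le _ n))))
    rwa [← hU] at hyU
  rw [h]
  infer_instance

open Set in
/-- A compact space in which every closed set is a Gδ set is hereditarily Lindelöf. -/
theorem HereditarilyLindelofSpace.of_compactSpace_of_isGδ {Y : Type*} [TopologicalSpace Y]
    [CompactSpace Y] (h : ∀ C : Set Y, IsClosed C → IsGδ C) : HereditarilyLindelofSpace Y := by
  refine .of_forall_isOpen fun s hs ↦ ?_
  obtain ⟨U, hUo, hU⟩ := isGδ_iff_eq_iInter_nat.1 (h _ hs.isClosed_compl)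
  have hs' : s = ⋃ n, (U n)ᶜ := by rw [← compl_iInter, ← hU, compl_compl]
  rw [hs']
  exact isLindelof_iUnion fun n ↦ (hUo n).isClosed_compl.isCompact.isLindelof

/-- If every first countable, hereditarily Lindelöf, regular Hausdorff space is
hereditarily separable, then every locally compact, Hausdorff, perfectly normal
space is locally separable: every point has a separable neighborhood. -/
theorem locallyCompact_perfectlyNormal_locallySeparable
    (H : ∀ (Y : Type u) [TopologicalSpace Y],
      FirstCountableTopology Y → HereditarilyLindelofSpace Y → T3Space Y →
        ∀ s : Set Y, TopologicalSpace.IsSeparable s)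
    (X : Type u) [TopologicalSpace X] [T2Space X] [WeaklyLocallyCompactSpace X]
    [PerfectlyNormalSpace X] :
    ∀ x : X, ∃ s ∈ nhds x, TopologicalSpace.IsSeparable s := by
  intro x
  obtain ⟨K, hK, hKx⟩ := exists_compact_mem_nhds x
  refine ⟨K, hKx, ?_⟩
  have : CompactSpace K := isCompact_iff_compactSpace.1 hK
  have hG : ∀ C : Set K, IsClosed C → IsGδ C := fun C hC ↦ by
    have hC' : IsClosed ((↑) '' C : Set X) :=
      hK.isClosed.isClosedEmbedding_subtypeVal.isClosedMap _ hC
    rw [← Set.preimage_image_eq C Subtype.val_injective]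
    exact (PerfectlyNormalSpace.closed_gdelta hC').preimage continuous_subtype_val
  have hsep := H K ⟨fun p ↦ (hG {p} isClosed_singleton).isCountablyGenerated_nhds_of_compactSpace⟩
    (.of_compactSpace_of_isGδ hG) inferInstance Set.univ
  simpa using hsep.image continuous_subtype_val
end

section
/- Assume 𝔟 > ℵ₁ in the following form: for every family {f_α : α < ω₁} of functions from ℕ to ℕ there is a function g : ℕ → ℕ such that for every α < ω₁, f_α(n) ≤ g(n) for all but finitely many n. Then in every first countable, regular Hausdorff topological space of cardinality ℵ₁, any two disjoint closed sets, one of which is countable, are contained in disjoint open sets. -/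
/-- `𝔟 > ℵ₁`: every family of ℵ₁ many functions `ℕ → ℕ` is eventually dominated
by a single function `g : ℕ → ℕ`. -/
def BoundingGTAleph1 : Prop :=
  ∀ f : {α : Ordinal.{0} // α < omega1} → ℕ → ℕ, ∃ g : ℕ → ℕ,
    ∀ α, {n : ℕ | ¬ f α n ≤ g n}.Finite

open Set Filter Topology

theorem nonempty_equiv_lt_omega1 {X : Type*} (hcard : Cardinal.mk X = Cardinal.aleph 1) :
    Nonempty (X ≃ {α : Ordinal.{0} // α < omega1}) := by
  have h : Cardinal.mk {α : Ordinal.{0} // α < omega1} = Cardinal.aleph 1 := by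
    refine (Cardinal.mk_Iio_ordinal omega1).trans ?_
    rw [omega1, Cardinal.card_ord, Cardinal.lift_aleph, Ordinal.lift_one]
  rw [← Cardinal.lift_mk_eq', hcard, h]
  simp

/-- Under `𝔟 > ℵ₁`, families indexed by any type of cardinality `ℵ₁` are dominated. -/
theorem BoundingGTAleph1.exists_dominating (hb : BoundingGTAleph1) {X : Type*}
    (hcard : Cardinal.mk X = Cardinal.aleph 1) (f : X → ℕ → ℕ) :
    ∃ g : ℕ → ℕ, ∀ x, {n : ℕ | ¬ f x n ≤ g n}.Finite := by
  obtain ⟨e⟩ := nonempty_equiv_lt_omega1 hcard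
  obtain ⟨g, hg⟩ := hb fun α => f (e.symm α)
  exact ⟨g, fun x => by simpa using hg (e x)⟩

/-- (van Douwen) `𝔟 > ℵ₁` implies that in a first countable regular Hausdorff space
of cardinality ℵ₁, two disjoint closed sets, one of which is countable, have disjoint
open sets around them. -/
theorem bounding_gt_aleph1_separation (hb : BoundingGTAleph1)
    (X : Type*) [TopologicalSpace X] [FirstCountableTopology X] [T3Space X]
    (hcard : Cardinal.mk X = Cardinal.aleph 1)
    (A B : Set X) (hA : IsClosed A) (hB : IsClosed B) (hdisj : Disjoint A B)
    (hAcount : A.Countable) :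
    ∃ U V : Set X, IsOpen U ∧ IsOpen V ∧ A ⊆ U ∧ B ⊆ V ∧ Disjoint U V := by
  obtain rfl | hne := A.eq_empty_or_nonempty
  · exact ⟨∅, univ, isOpen_empty, isOpen_univ, by simp, by simp, by simp⟩
  obtain ⟨a, rfl⟩ := hAcount.exists_eq_range hne
  choose s hs using fun n => (𝓝 (a n)).exists_antitone_basis
  have hW : ∀ n, ∃ W ∈ 𝓝 (a n), IsClosed W ∧ W ⊆ Bᶜ := fun n =>
    exists_mem_nhds_isClosed_subset
      (hB.isOpen_compl.mem_nhds (disjoint_left.1 hdisj (mem_range_self n)))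
  choose W hWn hWc hWB using hW
  have hV : ∀ x, ∃ V, x ∈ B → V ∈ 𝓝 x ∧ IsClosed V ∧ V ⊆ (range a)ᶜ := fun x => by
    by_cases hx : x ∈ B
    · obtain ⟨V, hV⟩ := exists_mem_nhds_isClosed_subset
        (hA.isOpen_compl.mem_nhds (disjoint_right.1 hdisj hx))
      exact ⟨V, fun _ => hV⟩
    · exact ⟨∅, fun h => absurd h hx⟩
  choose V hV using hV
  have hf : ∀ x n, ∃ m, x ∈ B → s n m ⊆ (V x)ᶜ := fun x n => by
    by_cases hx : x ∈ B
    · obtain ⟨-, hVc, hVA⟩ := hV x hx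
      obtain ⟨m, hm⟩ := (hs n).mem_iff.1
        (hVc.isOpen_compl.mem_nhds fun h => hVA h (mem_range_self n))
      exact ⟨m, fun _ => hm⟩
    · exact ⟨0, fun h => absurd h hx⟩
  choose f hf using hf
  obtain ⟨g, hg⟩ := hb.exists_dominating hcard f
  refine ⟨⋃ n, interior (s n (g n) ∩ W n), (closure (⋃ n, interior (s n (g n) ∩ W n)))ᶜ,
    isOpen_iUnion fun n => isOpen_interior, isClosed_closure.isOpen_compl, ?_, ?_,
    disjoint_compl_right.mono_left subset_closure⟩
  · rintro _ ⟨n, rfl⟩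
    exact mem_iUnion.2 ⟨n, mem_interior_iff_mem_nhds.2 (inter_mem ((hs n).mem _) (hWn n))⟩
  · intro x hx
    rw [mem_compl_iff, mem_closure_iff_nhds]
    push Not
    refine ⟨V x ∩ ⋂ n ∈ {n | ¬ f x n ≤ g n}, (W n)ᶜ, inter_mem (hV x hx).1
      ((biInter_mem (hg x)).2 fun n _ =>
        (hWc n).isOpen_compl.mem_nhds fun h => hWB n h hx), ?_⟩
    refine eq_empty_of_forall_notMem ?_
    rintro y ⟨⟨hyV, hyW⟩, hyU⟩
    obtain ⟨n, hn⟩ := mem_iUnion.1 hyU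
    obtain ⟨hys, hyWn⟩ := interior_subset hn
    by_cases hle : f x n ≤ g n
    · exact hf x n hx ((hs n).antitone hle hys) hyV
    · exact mem_iInter₂.1 hyW n hle hyWn
end

section
/- Assume that for every family {f_α : α < ω₁} of functions from ℕ to ℕ there is a function g : ℕ → ℕ such that for every α < ω₁, f_α(n) ≤ g(n) for all but finitely many n (i.e., 𝔟 > ℵ₁). Let X be a first countable, regular, T1 topological space of cardinality ℵ₁ such that every point of X has a countable open neighborhood and every open subset of X is countable or co-countable (has countable complement). Then X is perfectly normal. -/
open Set Topology in
/-- Under `𝔟 > ℵ₁`, a countable closed set in a first countable regular space of cardinality `ℵ₁`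
is a countable intersection of the closures of its open neighborhoods. -/
theorem BoundingGTAleph1.exists_isOpen_iInter_closure_eq (hb : BoundingGTAleph1)
    {X : Type*} [TopologicalSpace X] [FirstCountableTopology X] [RegularSpace X]
    (hcard : Cardinal.mk X = Cardinal.aleph 1) {A : Set X} (hA : A.Countable)
    (hAc : IsClosed A) :
    ∃ G : ℕ → Set X, (∀ m, IsOpen (G m)) ∧ (∀ m, A ⊆ G m) ∧ ⋂ m, closure (G m) = A := by
  rcases A.eq_empty_or_nonempty with rfl | hne
  · exact ⟨fun _ => ∅, by simp, by simp, by simp [iInter_const]⟩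
  obtain ⟨a, rfl⟩ := hA.exists_eq_range hne
  choose s hs using fun n => (𝓝 (a n)).exists_antitone_basis
  have key : ∀ x : X, ∃ f : ℕ → ℕ, x ∉ range a →
      ∃ C ∈ 𝓝 x, ∀ n, Disjoint (s n (f n)) C := by
    intro x
    by_cases hx : x ∈ range a
    · exact ⟨0, fun h => absurd hx h⟩
    obtain ⟨C, hC, hCc, hCA⟩ := exists_mem_nhds_isClosed_subset (hAc.isOpen_compl.mem_nhds hx)
    have hk : ∀ n, ∃ k, s n k ⊆ Cᶜ := fun n => by
      obtain ⟨k, -, hk⟩ := (hs n).toHasBasis.mem_iff.1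
        (hCc.isOpen_compl.mem_nhds fun h => hCA h (mem_range_self n))
      exact ⟨k, hk⟩
    choose f hf using hk
    exact ⟨f, fun _ => ⟨C, hC, fun n => disjoint_left.2 (hf n)⟩⟩
  choose f hf using key
  obtain ⟨e⟩ : Nonempty (X ↪ {α : Ordinal.{0} // α < omega1}) := by
    rw [← Cardinal.lift_mk_le', hcard]
    have : Cardinal.mk {α : Ordinal.{0} // α < omega1} = Cardinal.aleph 1 := by
      refine (Cardinal.mk_Iio_ordinal omega1).trans ?_
      rw [omega1, Cardinal.card_ord, Cardinal.lift_aleph, Ordinal.lift_one]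
    rw [this]
    simp
  obtain ⟨g, hg⟩ := hb (Function.extend e f 0)
  have hgx : ∀ x, {n | ¬ f x n ≤ g n}.Finite := fun x => by
    simpa [e.injective.extend_apply] using hg (e x)
  refine ⟨fun m => ⋃ n, interior (s n (max (g n) m)),
    fun m => isOpen_iUnion fun n => isOpen_interior, ?_, ?_⟩
  · rintro m _ ⟨n, rfl⟩
    exact mem_iUnion.2 ⟨n, mem_interior_iff_mem_nhds.2 ((hs n).mem _)⟩
  refine Subset.antisymm (fun x hx => ?_) (subset_iInter fun m => ?_)
  · by_contra hxA
    obtain ⟨C, hC, hd⟩ := hf x hxA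
    have hm := mem_iInter.1 hx ((hgx x).toFinset.sup (f x))
    obtain ⟨y, hyC, hy⟩ := mem_closure_iff_nhds.1 hm C hC
    obtain ⟨n, hn⟩ := mem_iUnion.1 hy
    refine disjoint_left.1 (hd n) ((hs n).antitone ?_ (interior_subset hn)) hyC
    by_cases h : f x n ≤ g n
    · exact le_max_of_le_left h
    · exact le_max_of_le_right (Finset.le_sup ((hgx x).mem_toFinset.2 h))
  · rintro _ ⟨n, rfl⟩
    exact subset_closure (mem_iUnion.2 ⟨n, mem_interior_iff_mem_nhds.2 ((hs n).mem _)⟩)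

open Set Topology in
/-- In a regular space, a countable set which is a countable intersection of closures of its open
neighborhoods can be separated from every closed set disjoint from it. -/
theorem separatedNhds_of_countable_of_iInter_closure_eq
    {X : Type*} [TopologicalSpace X] [RegularSpace X] {A B : Set X} (hA : A.Countable)
    (hB : IsClosed B) (hAB : Disjoint A B) {G : ℕ → Set X} (hGo : ∀ m, IsOpen (G m))
    (hAG : ∀ m, A ⊆ G m) (hG : ⋂ m, closure (G m) = A) : SeparatedNhds A B := by
  refine hasSeparatingCovers_iff_separatedNhds.1 ⟨?_, fun m => (closure (G m))ᶜ, ?_, fun m =>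
    ⟨isClosed_closure.isOpen_compl, ?_⟩⟩
  · rcases A.eq_empty_or_nonempty with rfl | hne
    · exact ⟨fun _ => ∅, by simp, by simp⟩
    obtain ⟨a, rfl⟩ := hA.exists_eq_range hne
    have h : ∀ n, ∃ u, IsOpen u ∧ a n ∈ u ∧ Disjoint (closure u) B := fun n => by
      obtain ⟨C, hC, hCc, hCB⟩ := exists_mem_nhds_isClosed_subset
        (hB.isOpen_compl.mem_nhds (disjoint_left.1 hAB (mem_range_self n)))
      exact ⟨interior C, isOpen_interior, mem_interior_iff_mem_nhds.2 hC,
        disjoint_left.2 fun x hx => hCB (closure_minimal interior_subset hCc hx)⟩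
    choose u huo hau hu using h
    refine ⟨u, ?_, fun n => ⟨huo n, hu n⟩⟩
    rintro _ ⟨n, rfl⟩
    exact mem_iUnion.2 ⟨n, hau n⟩
  · rw [← compl_iInter, hG]
    exact hAB.subset_compl_left
  · have h : closure (closure (G m))ᶜ ⊆ (G m)ᶜ :=
      closure_minimal (compl_subset_compl.2 subset_closure) (hGo m).isClosed_compl
    exact disjoint_left.2 fun x hx hxA => h hx (hAG m hxA)

/-- Assume `𝔟 > ℵ₁`. A first countable, regular, T1 space of cardinality ℵ₁ in which
every point has a countable open neighborhood and every open set is countable or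
co-countable is perfectly normal. -/
theorem soukup_space_perfectlyNormal (hb : BoundingGTAleph1)
    (X : Type*) [TopologicalSpace X] [FirstCountableTopology X] [RegularSpace X]
    [T1Space X] (hcard : Cardinal.mk X = Cardinal.aleph 1)
    (hloc : ∀ x : X, ∃ U : Set X, IsOpen U ∧ x ∈ U ∧ U.Countable)
    (hopen : ∀ U : Set X, IsOpen U → U.Countable ∨ Uᶜ.Countable) :
    PerfectlyNormalSpace X := by
  have hsep : ∀ A B : Set X, IsClosed A → IsClosed B → Disjoint A B → A.Countable →
      SeparatedNhds A B := fun A B hA hB hAB hAc => by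
    obtain ⟨G, hGo, hAG, hG⟩ := hb.exists_isOpen_iInter_closure_eq hcard hAc hA
    exact separatedNhds_of_countable_of_iInter_closure_eq hAc hB hAB hGo hAG hG
  refine { normal := fun A B hA hB hAB => ?_, closed_gdelta := fun A hA => ?_ }
  · rcases hopen Aᶜ hA.isOpen_compl with h | h
    · exact (hsep B A hB hA hAB.symm (h.mono hAB.subset_compl_left)).symm
    · exact hsep A B hA hB hAB (by rwa [compl_compl] at h)
  · rcases hopen Aᶜ hA.isOpen_compl with h | h
    · simpa using h.isGδ_compl
    · rw [compl_compl] at h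
      obtain ⟨G, hGo, hAG, hG⟩ := hb.exists_isOpen_iInter_closure_eq hcard h hA
      have hGA : A = ⋂ m, G m := (Set.subset_iInter hAG).antisymm
        ((Set.iInter_mono fun m => subset_closure).trans hG.subset)
      rw [hGA]
      exact IsGδ.iInter_of_isOpen hGo
end

section
/- Assume that for every family {f_α : α < ω₁} of functions from ℕ to ℕ there is a function g : ℕ → ℕ such that for every α < ω₁, f_α(n) ≤ g(n) for all but finitely many n (i.e., 𝔟 > ℵ₁). Let X be a first countable, regular, T1 topological space of cardinality ℵ₁ in which every open subset is countable or co-countable (has countable complement). Then X is hereditarily normal, i.e., every subspace of X is normal. -/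
open Topology in
/-- Under `𝔟 > ℵ₁`, in a first countable regular space of size `ℵ₁` a countable set can be
separated from any set it is (topologically) separated from. -/
theorem BoundingGTAleph1.separatedNhds_of_countable (hb : BoundingGTAleph1)
    {X : Type*} [TopologicalSpace X] [FirstCountableTopology X] [RegularSpace X]
    (hcard : Cardinal.mk X = Cardinal.aleph 1) {A B : Set X} (hA : A.Countable)
    (hAB : Disjoint (closure A) B) (hBA : Disjoint A (closure B)) : SeparatedNhds A B := by
  rcases A.eq_empty_or_nonempty with rfl | hne
  · exact SeparatedNhds.empty_left B
  obtain ⟨a, rfl⟩ := hA.exists_eq_range hne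
  have hequiv : Nonempty (X ≃ {α : Ordinal.{0} // α < omega1}) := by
    rw [← Cardinal.lift_mk_eq', hcard]
    have := Cardinal.mk_Iio_ordinal omega1
    change Cardinal.mk {α : Ordinal.{0} // α < omega1} = _ at this
    rw [this]
    simp [omega1]
  obtain ⟨e⟩ := hequiv
  -- decreasing neighbourhood bases at the points of `A`, with closures missing `B`
  have hbase : ∀ n, ∃ U : ℕ → Set X, (𝓝 (a n)).HasAntitoneBasis U ∧
      ∀ k, closure (U k) ⊆ Bᶜ := by
    intro n
    have hn : (closure B)ᶜ ∈ 𝓝 (a n) :=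
      isClosed_closure.compl_mem_nhds (Set.disjoint_left.mp hBA ⟨n, rfl⟩)
    obtain ⟨W, hW, hWc, hWB⟩ := exists_mem_nhds_isClosed_subset hn
    obtain ⟨U, hU⟩ := (𝓝 (a n)).exists_antitone_basis
    obtain ⟨m, hm⟩ := hU.mem_iff.mp hW
    refine ⟨fun k ↦ U (k + m), ?_, fun k ↦ ?_⟩
    · exact hU.comp_strictMono fun i j hij ↦ Nat.add_lt_add_right hij m
    · exact (closure_minimal ((hU.antitone (Nat.le_add_left m k)).trans hm) hWc).trans
        (hWB.trans (Set.compl_subset_compl.mpr subset_closure))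
  choose U hU hUB using hbase
  have hsep : ∀ b, ∃ V : Set X, ∃ f : ℕ → ℕ, b ∈ B →
      V ∈ 𝓝 b ∧ ∀ n, Disjoint (U n (f n)) V := by
    intro b
    by_cases hbB : b ∈ B
    · obtain ⟨V, hV, hVc, hVA⟩ := exists_mem_nhds_isClosed_subset
        (isClosed_closure.compl_mem_nhds (Set.disjoint_right.mp hAB hbB))
      have hk : ∀ n, ∃ k, Disjoint (U n k) V := by
        intro n
        have hn : Vᶜ ∈ 𝓝 (a n) := hVc.compl_mem_nhds fun h ↦ hVA h (subset_closure ⟨n, rfl⟩)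
        obtain ⟨k, hk⟩ := (hU n).mem_iff.mp hn
        exact ⟨k, Set.disjoint_left.mpr hk⟩
      choose f hf using hk
      exact ⟨V, f, fun _ ↦ ⟨hV, hf⟩⟩
    · exact ⟨∅, 0, fun h ↦ (hbB h).elim⟩
  choose V f hVf using hsep
  obtain ⟨g, hg⟩ := hb fun α ↦ f (e.symm α)
  rw [separatedNhds_iff_disjoint, Filter.disjoint_iff]
  refine ⟨⋃ n, U n (g n), ?_, (closure (⋃ n, U n (g n)))ᶜ, ?_,
    (disjoint_compl_right).mono_left subset_closure⟩
  · rw [mem_nhdsSet_iff_forall]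
    rintro _ ⟨n, rfl⟩
    exact Filter.mem_of_superset ((hU n).mem (g n)) (Set.subset_iUnion (fun n ↦ U n (g n)) n)
  · refine (isClosed_closure.isOpen_compl.mem_nhdsSet).mpr fun b hbB ↦ ?_
    obtain ⟨hV, hf⟩ := hVf b hbB
    have hfin : {n : ℕ | ¬ f b n ≤ g n}.Finite := by simpa using hg (e b)
    have hN : (⋂ n ∈ {n : ℕ | ¬ f b n ≤ g n}, (closure (U n (g n)))ᶜ) ∈ 𝓝 b :=
      (Filter.biInter_mem hfin).mpr fun n _ ↦
        isClosed_closure.compl_mem_nhds fun h ↦ hUB n (g n) h hbB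
    rw [Set.mem_compl_iff, mem_closure_iff_nhds]
    intro h
    obtain ⟨x, ⟨hxV, hxN⟩, hxU⟩ := h _ (Filter.inter_mem hV hN)
    obtain ⟨n, hxn⟩ := Set.mem_iUnion.mp hxU
    by_cases hn : f b n ≤ g n
    · exact Set.disjoint_left.mp (hf n) ((hU n).antitone hn hxn) hxV
    · exact Set.mem_iInter₂.mp hxN n hn (subset_closure hxn)

/-- Assume `𝔟 > ℵ₁`. A first countable, regular, T1 space of cardinality ℵ₁ in which
every open set is countable or co-countable is hereditarily normal: every subspace
is normal. -/
theorem soukup_space_hereditarilyNormal (hb : BoundingGTAleph1)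
    (X : Type*) [TopologicalSpace X] [FirstCountableTopology X] [RegularSpace X]
    [T1Space X] (hcard : Cardinal.mk X = Cardinal.aleph 1)
    (hopen : ∀ U : Set X, IsOpen U → U.Countable ∨ Uᶜ.Countable) :
    ∀ s : Set X, NormalSpace s := by
  have : CompletelyNormalSpace X := by
    refine ⟨fun A B hAB hBA ↦ separatedNhds_iff_disjoint.mp ?_⟩
    rcases hopen _ (isClosed_closure (s := A)).isOpen_compl with h | h
    · have hB : B.Countable := h.mono hAB.subset_compl_left
      exact (hb.separatedNhds_of_countable hcard hB hBA.symm hAB.symm).symm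
    · rw [compl_compl] at h
      exact hb.separatedNhds_of_countable hcard (h.mono subset_closure) hAB hBA
  exact fun s ↦ inferInstance
end
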